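/- arXiv:2505.01670 — 2 statements merged into one kernel-verified Lean document; each statement's English description precedes it below -/
import Mathlib

section
/- Greedy step lemma: let k ≥ 1, let OPT_k = max{Cov(T) : T ⊆ I, |T| ≤ k}, and let S ⊆ I be any finite subset with I \ S nonempty. If x* ∈ I maximizes Cov(S ∪ {x}) over all x ∈ I, then k · (Cov(S ∪ {x*}) − Cov(S)) ≥ OPT_k − Cov(S); that is, the best single-image marginal gain is at least (OPT_k − Cov(S))/k. -/
/-- `gapDim B b S j` is the number of bins in dimension `j` (out of `B j` bins)
not covered by the set of images `S`. -/
def gapDim {ι : Type*} [DecidableEq ι] {d : ℕ} (B : Fin d → ℕ)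
    (b : (j : Fin d) → ι → Fin (B j)) (S : Finset ι) (j : Fin d) : ℕ :=
  (Finset.univ.filter (fun β : Fin (B j) => ∀ i ∈ S, b j i ≠ β)).card

/-- `cov B b S` is the total number of covered bins, `Σ_j (B j − Gap(S,j))`. -/
def cov {ι : Type*} [DecidableEq ι] {d : ℕ} (B : Fin d → ℕ)
    (b : (j : Fin d) → ι → Fin (B j)) (S : Finset ι) : ℕ :=
  ∑ j : Fin d, (B j - gapDim B b S j)

/-- `optCov B b k` is the maximum coverage achievable by a subset of at most
`k` images: `OPT_k = max { Cov(T) : T ⊆ I, |T| ≤ k }`. -/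
def optCov {ι : Type*} [Fintype ι] [DecidableEq ι] {d : ℕ} (B : Fin d → ℕ)
    (b : (j : Fin d) → ι → Fin (B j)) (k : ℕ) : ℕ :=
  ((Finset.univ : Finset (Finset ι)).filter (fun T => T.card ≤ k)).sup (cov B b)

theorem gs_cov_eq {ι : Type*} [DecidableEq ι] {d : ℕ} (B : Fin d → ℕ)
    (b : (j : Fin d) → ι → Fin (B j)) (S : Finset ι) :
    cov B b S = (S.biUnion (fun i => Finset.univ.image
      (fun j : Fin d => (⟨j, b j i⟩ : (j : Fin d) × Fin (B j))))).card := by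
  have h1 : S.biUnion (fun i => Finset.univ.image
      (fun j : Fin d => (⟨j, b j i⟩ : (j : Fin d) × Fin (B j))))
      = Finset.univ.sigma (fun j => S.image (b j)) := by
    ext ⟨j, β⟩
    simp only [Finset.mem_biUnion, Finset.mem_image, Finset.mem_univ, true_and,
      Finset.mem_sigma]
    constructor
    · rintro ⟨i, hi, j', h⟩
      cases h
      exact ⟨i, hi, rfl⟩
    · rintro ⟨i, hi, rfl⟩
      exact ⟨i, hi, j, rfl⟩
  rw [h1, Finset.card_sigma, cov]
  refine Finset.sum_congr rfl fun j _ => ?_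
  have h2 : Finset.univ.filter (fun β : Fin (B j) => ∀ i ∈ S, b j i ≠ β)
      = (S.image (b j))ᶜ := by
    ext β
    simp
  have h3 := Finset.card_le_univ (S.image (b j))
  rw [gapDim, h2, Finset.card_compl]
  simp only [Fintype.card_fin] at *
  omega

theorem gs_card_step {α : Type*} [DecidableEq α] (U V F : Finset α) (h : U ⊆ V) :
    (F ∪ V).card + U.card ≤ V.card + (F ∪ U).card := by
  have h1 := Finset.card_sdiff_add_card F V
  have h2 := Finset.card_sdiff_add_card F U
  have h3 := Finset.card_le_card (Finset.sdiff_subset_sdiff (Finset.Subset.refl F) h)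
  omega

/-- Greedy step lemma: if `k ≥ 1`, `S` is a finite subset of the finite set of
images with `I \ S` nonempty, and `x*` maximizes `Cov(S ∪ {x})` over all
images `x ∈ I`, then `k · (Cov(S ∪ {x*}) − Cov(S)) ≥ OPT_k − Cov(S)`. -/
theorem greedy_step {ι : Type*} [Fintype ι] [DecidableEq ι]
    {d : ℕ} (B : Fin d → ℕ) (hB : ∀ j, 1 ≤ B j)
    (b : (j : Fin d) → ι → Fin (B j))
    (k : ℕ) (hk : 1 ≤ k) (S : Finset ι)
    (hS : ((Finset.univ : Finset ι) \ S).Nonempty)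
    (xstar : ι)
    (hxstar : ∀ x : ι, cov B b (insert x S) ≤ cov B b (insert xstar S)) :
    (optCov B b k : ℤ) - cov B b S ≤
      (k : ℤ) * ((cov B b (insert xstar S) : ℤ) - cov B b S) := by
  have mono : ∀ A A' : Finset ι, A ⊆ A' → cov B b A ≤ cov B b A' := by
    intro A A' h
    rw [gs_cov_eq, gs_cov_eq]
    exact Finset.card_le_card (Finset.biUnion_subset_biUnion_of_subset_left _ h)
  have key : ∀ T : Finset ι, (cov B b (T ∪ S) : ℤ) ≤ cov B b S +
      (T.card : ℤ) * ((cov B b (insert xstar S) : ℤ) - cov B b S) := by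
    intro T
    induction T using Finset.induction_on with
    | empty => simp
    | insert x T hx ih =>
      have h1 : cov B b (insert x (T ∪ S)) + cov B b S
          ≤ cov B b (T ∪ S) + cov B b (insert x S) := by
        simp only [gs_cov_eq, Finset.biUnion_insert]
        exact gs_card_step _ _ _
          (Finset.biUnion_subset_biUnion_of_subset_left _ Finset.subset_union_right)
      have h2 := hxstar x
      rw [Finset.insert_union, Finset.card_insert_of_notMem hx]
      push_cast
      rw [add_mul]
      zify at h1 h2
      linarith
  have hopt : ∃ T : Finset ι, T.card ≤ k ∧ optCov B b k = cov B b T := by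
    obtain ⟨T, hT, h⟩ := Finset.exists_mem_eq_sup
      ((Finset.univ : Finset (Finset ι)).filter (fun T => T.card ≤ k))
      ⟨∅, by simp⟩ (cov B b)
    exact ⟨T, (Finset.mem_filter.mp hT).2, h⟩
  obtain ⟨T, hT, h⟩ := hopt
  rw [h]
  have h1 := key T
  have h2 := mono T (T ∪ S) Finset.subset_union_left
  have h3 := mono S (insert xstar S) (Finset.subset_insert _ _)
  zify at h2 h3 hT
  have h4 := mul_le_mul_of_nonneg_right hT (sub_nonneg.mpr h3)
  linarith
end

section
/- Greedy (1 − 1/e) approximation guarantee for bin coverage: let k ≥ 1, OPT_k = max{Cov(T) : T ⊆ I, |T| ≤ k}, and let S_0 = ∅ and S_{t+1} = S_t ∪ {x_t} where x_t ∈ I maximizes Cov(S_t ∪ {x}) over x ∈ I. Then Cov(S_k) ≥ (1 − (1 − 1/k)^k) · OPT_k ≥ (1 − 1/e) · OPT_k; equivalently, since Cov(S) = Gap(∅) − Gap(S) when every bin of Gap(∅) counts all B_j bins, the greedy algorithm reduces the total gap by at least a (1 − 1/e) fraction of the best possible reduction achievable with k images. -/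
theorem cov_eq_aux {ι : Type*} [DecidableEq ι] {d : ℕ} (B : Fin d → ℕ)
    (b : (j : Fin d) → ι → Fin (B j)) (S : Finset ι) :
    cov B b S = ∑ j : Fin d, (S.image (b j)).card := by
  unfold cov gapDim
  refine Finset.sum_congr rfl fun j _ => ?_
  have h : (Finset.univ.filter (fun β : Fin (B j) => ∀ i ∈ S, b j i ≠ β)) = (S.image (b j))ᶜ := by
    ext β; simp
  rw [h, Finset.card_compl, Fintype.card_fin]
  have := Finset.card_le_univ (S.image (b j))
  rw [Fintype.card_fin] at this
  omega

theorem cov_mono_aux {ι : Type*} [DecidableEq ι] {d : ℕ} (B : Fin d → ℕ)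
    (b : (j : Fin d) → ι → Fin (B j)) {S A : Finset ι} (h : S ⊆ A) :
    cov B b S ≤ cov B b A := by
  rw [cov_eq_aux, cov_eq_aux]
  exact Finset.sum_le_sum fun j _ => Finset.card_le_card (Finset.image_subset_image h)

theorem cov_submod_aux {ι : Type*} [DecidableEq ι] {d : ℕ} (B : Fin d → ℕ)
    (b : (j : Fin d) → ι → Fin (B j)) {S A : Finset ι} (h : S ⊆ A) (y : ι) :
    cov B b (insert y A) + cov B b S ≤ cov B b A + cov B b (insert y S) := by
  simp only [cov_eq_aux, ← Finset.sum_add_distrib]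
  refine Finset.sum_le_sum fun j _ => ?_
  rw [Finset.image_insert, Finset.image_insert]
  have hs : S.image (b j) ⊆ A.image (b j) := Finset.image_subset_image h
  by_cases h1 : b j y ∈ A.image (b j)
  · rw [Finset.insert_eq_of_mem h1]
    have := Finset.card_le_card (Finset.subset_insert (b j y) (S.image (b j)))
    omega
  · rw [Finset.card_insert_of_notMem h1, Finset.card_insert_of_notMem (fun h2 => h1 (hs h2))]
    omega

theorem cov_union_aux {ι : Type*} [DecidableEq ι] {d : ℕ} (B : Fin d → ℕ)
    (b : (j : Fin d) → ι → Fin (B j)) (S : Finset ι) (m : ℕ)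
    (hm : ∀ y, cov B b (insert y S) ≤ cov B b S + m) (T : Finset ι) :
    cov B b (T ∪ S) ≤ cov B b S + T.card * m := by
  induction T using Finset.induction_on with
  | empty => simp
  | insert y T hy ih =>
    rw [Finset.insert_union, Finset.card_insert_of_notMem hy]
    have h1 := cov_submod_aux B b (Finset.subset_union_right (s₁ := T) (s₂ := S)) y
    have h2 := hm y
    rw [add_mul]
    omega

/-- Greedy `(1 − 1/e)` approximation guarantee for bin coverage: if `S 0 = ∅`
and each `S (t+1) = S t ∪ {x_t}` where `x_t` maximizes `Cov(S t ∪ {x})` over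
`x ∈ I`, then after `k` steps
`Cov(S k) ≥ (1 − (1 − 1/k)^k) · OPT_k ≥ (1 − 1/e) · OPT_k`. -/
theorem greedy_one_sub_inv_e_approx {ι : Type*} [Fintype ι] [DecidableEq ι]
    {d : ℕ} (B : Fin d → ℕ) (hB : ∀ j, 1 ≤ B j)
    (b : (j : Fin d) → ι → Fin (B j))
    (k : ℕ) (hk : 1 ≤ k) (S : ℕ → Finset ι)
    (hS0 : S 0 = ∅)
    (hstep : ∀ t : ℕ, ∃ x : ι,
      (∀ y : ι, cov B b (insert y (S t)) ≤ cov B b (insert x (S t))) ∧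
      S (t + 1) = insert x (S t)) :
    (1 - 1 / Real.exp 1) * optCov B b k ≤
        (1 - (1 - 1 / (k : ℝ)) ^ k) * optCov B b k ∧
      (1 - (1 - 1 / (k : ℝ)) ^ k) * optCov B b k ≤ cov B b (S k) := by
  have hk0 : (0 : ℝ) < k := by exact_mod_cast hk
  have hk1 : (1 : ℝ) / k ≤ 1 := by
    rw [div_le_one hk0]; exact_mod_cast hk
  constructor
  · refine mul_le_mul_of_nonneg_right ?_ (Nat.cast_nonneg _)
    have h1 : (1 - 1 / (k : ℝ)) ≤ Real.exp (-(1 / (k : ℝ))) := by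
      have := Real.add_one_le_exp (-(1 / (k : ℝ)))
      linarith
    have h2 : (1 - 1 / (k : ℝ)) ^ k ≤ Real.exp (-(1 / (k : ℝ))) ^ k :=
      pow_le_pow_left₀ (by linarith) h1 k
    rw [← Real.exp_nat_mul] at h2
    have h3 : (k : ℝ) * (-(1 / (k : ℝ))) = -1 := by field_simp
    rw [h3, Real.exp_neg] at h2
    rw [one_div (Real.exp 1)]
    linarith
  · have key : ∀ t, (optCov B b k : ℝ) ≤
        cov B b (S t) + k * ((cov B b (S (t + 1)) : ℝ) - cov B b (S t)) := by
      intro t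
      obtain ⟨x, hx, hxS⟩ := hstep t
      have hmono : cov B b (S t) ≤ cov B b (S (t + 1)) := by
        rw [hxS]; exact cov_mono_aux B b (Finset.subset_insert _ _)
      obtain ⟨m, hm⟩ := Nat.exists_eq_add_of_le hmono
      have hopt : optCov B b k ≤ cov B b (S t) + k * m := by
        unfold optCov
        refine Finset.sup_le fun T hT => ?_
        have hT' : T.card ≤ k := by simpa using hT
        calc cov B b T ≤ cov B b (T ∪ S t) := cov_mono_aux B b Finset.subset_union_left
          _ ≤ cov B b (S t) + T.card * m := by
            refine cov_union_aux B b (S t) m (fun y => ?_) T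
            rw [← hm, hxS]; exact hx y
          _ ≤ _ := by gcongr
      rw [hm]
      push_cast
      have : (optCov B b k : ℝ) ≤ cov B b (S t) + k * m := by exact_mod_cast hopt
      linarith
    have main : ∀ t, (optCov B b k : ℝ) - cov B b (S t) ≤
        (1 - 1 / (k : ℝ)) ^ t * optCov B b k := by
      intro t
      induction t with
      | zero => simp
      | succ t ih =>
        have h1 : ((optCov B b k : ℝ) - cov B b (S t)) / k ≤
            (cov B b (S (t + 1)) : ℝ) - cov B b (S t) := by
          rw [div_le_iff₀ hk0]
          linarith [key t]
        have h2 := mul_le_mul_of_nonneg_left ih (show (0 : ℝ) ≤ 1 - 1 / k by linarith)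
        calc (optCov B b k : ℝ) - cov B b (S (t + 1))
            ≤ (optCov B b k : ℝ) - cov B b (S t) - ((optCov B b k : ℝ) - cov B b (S t)) / k := by
              linarith
          _ = (1 - 1 / (k : ℝ)) * ((optCov B b k : ℝ) - cov B b (S t)) := by ring
          _ ≤ _ := h2
          _ = _ := by ring
    linarith [main k]
end
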